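/- arXiv:1410.7905 — 5 statements merged into one kernel-verified Lean document; each statement's English description precedes it below -/
import Mathlib

section
/- Let n ≥ 1, let W_1, …, W_n be finite nonempty subsets of ℝ^n and let a_i : W_i → ℝ be coefficient maps defining tropical polynomials f_1, …, f_n. Then the set of nondegenerate solutions of the tropical polynomial system is finite, and its cardinality is at most the Kouchnirenko number ∏_{i=1}^n (|W_i| − 1). -/
open scoped Pointwise

/-- The tropical polynomial with support `W ⊂ ℝ^n` and coefficient map `a`:
`f(x) = max_{w ∈ W} (a w + ⟨w, x⟩)`. -/
noncomputable def tropVal {n : ℕ} (W : Finset (Fin n → ℝ)) (hW : W.Nonempty)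
    (a : (Fin n → ℝ) → ℝ) (x : Fin n → ℝ) : ℝ :=
  W.sup' hW fun w => a w + ∑ j, w j * x j

/-- The set of maximizers `S(x) = {w ∈ W : a w + ⟨w, x⟩ = f(x)}`. -/
noncomputable def tropArgmax {n : ℕ} (W : Finset (Fin n → ℝ)) (hW : W.Nonempty)
    (a : (Fin n → ℝ) → ℝ) (x : Fin n → ℝ) : Finset (Fin n → ℝ) :=
  W.filter fun w => a w + ∑ j, w j * x j = tropVal W hW a x

/-- `x` is a nondegenerate solution of the tropical system with supports `W i` and
coefficient maps `a i`. -/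
noncomputable def IsNondegTropSol {n : ℕ} (W : Fin n → Finset (Fin n → ℝ))
    (hW : ∀ i, (W i).Nonempty) (a : Fin n → (Fin n → ℝ) → ℝ) (x : Fin n → ℝ) : Prop :=
  (∀ i, Module.finrank ℝ
      (vectorSpan ℝ ((tropArgmax (W i) (hW i) (a i) x : Set (Fin n → ℝ)))) = 1) ∧
  (⨆ i, vectorSpan ℝ ((tropArgmax (W i) (hW i) (a i) x : Set (Fin n → ℝ)))) = ⊤

/-- A family of vectors is linearly independent if it is triangular, with nonzero diagonal, with
respect to some family of linear functionals and some real-valued height on the index type. -/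
theorem linearIndependent_of_triangular {ι V : Type*} [AddCommGroup V] [Module ℝ V]
    (v : ι → V) (φ : ι → V →ₗ[ℝ] ℝ) (h : ι → ℝ) (hdiag : ∀ i, φ i (v i) ≠ 0)
    (htri : ∀ i j, φ j (v i) ≠ 0 → i ≠ j → h j < h i) : LinearIndependent ℝ v := by
  classical
  rw [linearIndependent_iff']
  intro s g hsum
  by_contra! hne
  obtain ⟨i₀, hi₀, hgi₀⟩ := hne
  obtain ⟨i, hi, hmax⟩ := (s.filter fun i => g i ≠ 0).exists_max_image h
    ⟨i₀, Finset.mem_filter.2 ⟨hi₀, hgi₀⟩⟩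
  rw [Finset.mem_filter] at hi
  -- the terms other than `i` could only contribute if `i` lay strictly below them
  have key : ∃ j ∈ s, g j ≠ 0 ∧ j ≠ i ∧ φ i (v j) ≠ 0 := by
    by_contra! hall
    have happ := congrArg (φ i) hsum
    rw [map_sum, map_zero, Finset.sum_eq_single i] at happ
    · simp only [map_smul, smul_eq_mul, mul_eq_zero] at happ
      exact happ.elim hi.2 (hdiag i)
    · intro j hj hji
      by_cases hg : g j = 0
      · simp [hg]
      · simp [hall j hj hg hji]
    · exact fun hni => absurd hi.1 hni
  obtain ⟨j, hj, hgj, hji, hφ⟩ := key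
  exact absurd (htri j i hφ hji) (not_lt.2 (hmax j (Finset.mem_filter.2 ⟨hj, hgj⟩)))

theorem exists_forall_notMem_of_ne_top {ι V : Type*} [Finite ι] [AddCommGroup V] [Module ℝ V]
    (p : ι → Submodule ℝ V) : ∃ c, ∀ i, p i ≠ ⊤ → c ∉ p i := by
  by_contra! h
  obtain ⟨⟨i, hi⟩, htop⟩ := Subspace.exists_eq_top_of_iUnion_eq_univ
    (p := fun i : {i // p i ≠ ⊤} => p i) (by
      ext c
      obtain ⟨i, hi, hc⟩ := h c
      simpa using ⟨i, hi, hc⟩)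
  exact hi htop

theorem exists_vectorSpan_eq_span_sub {V : Type*} [AddCommGroup V] [Module ℝ V] {s : Set V}
    (hs : Module.finrank ℝ (vectorSpan ℝ s) = 1) :
    ∃ p ∈ s, ∃ q ∈ s, p ≠ q ∧ vectorSpan ℝ s = Submodule.span ℝ {p - q} := by
  have hsub : ¬ s.Subsingleton := by
    intro h
    rw [vectorSpan_of_subsingleton ℝ h, finrank_bot] at hs
    exact zero_ne_one hs
  obtain ⟨p, hp, q, hq, hpq⟩ := Set.not_subsingleton_iff.1 hsub
  have hfin : FiniteDimensional ℝ (vectorSpan ℝ s) := Module.finite_of_finrank_eq_succ hs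
  refine ⟨p, hp, q, hq, hpq, (Submodule.eq_of_le_of_finrank_eq ?_ ?_).symm⟩
  · rw [Submodule.span_singleton_le_iff_mem]
    exact vsub_mem_vectorSpan ℝ hp hq
  · rw [hs, finrank_span_singleton (sub_ne_zero.2 hpq)]

/-- A difference of two point masses is determined by its values off one point `w₀`. -/
theorem sum_erase_single_sub_mul {α : Type*} [DecidableEq α] (s : Finset α) {w₀ p q : α}
    (hp : p ∈ s) (hq : q ∈ s) (v : α) :
    ∑ w : (s.erase w₀ : Finset α), ((if w.1 = p then 1 else 0) - (if w.1 = q then 1 else 0)) *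
      ((if w.1 = v then 1 else 0) - (if w₀ = v then 1 else 0)) =
    ((if p = v then 1 else 0) - (if q = v then 1 else 0) : ℝ) := by
  rw [Finset.sum_coe_sort (s.erase w₀) fun w => (((if w = p then 1 else 0) -
    (if w = q then 1 else 0)) * ((if w = v then 1 else 0) - (if w₀ = v then 1 else 0)) : ℝ)]
  rw [Finset.sum_erase _ (by simp)]
  simp [sub_mul, Finset.sum_sub_distrib, hp, hq]

/-- `p` and `q` select from each support an edge of `S_1(x), …, S_n(x)` so that the edge directions
`p i - q i` span the space and `c` has positive coordinates with respect to them. -/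
def IsEdgeSelection {n : ℕ} (W : Fin n → Finset (Fin n → ℝ))
    (hW : ∀ i, (W i).Nonempty) (a : Fin n → (Fin n → ℝ) → ℝ) (c x : Fin n → ℝ)
    (p q : Fin n → Fin n → ℝ) : Prop :=
  (∀ i, p i ∈ tropArgmax (W i) (hW i) (a i) x) ∧ (∀ i, q i ∈ tropArgmax (W i) (hW i) (a i) x) ∧
    (∀ i, p i ≠ q i) ∧ Submodule.span ℝ (Set.range fun i => p i - q i) = ⊤ ∧
    ∃ t : Fin n → ℝ, (∀ i, 0 < t i) ∧ ∑ i, t i • (p i - q i) = c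

theorem exists_isEdgeSelection {n : ℕ} (W : Fin n → Finset (Fin n → ℝ))
    (hW : ∀ i, (W i).Nonempty) (a : Fin n → (Fin n → ℝ) → ℝ) :
    ∃ c, ∀ x, IsNondegTropSol W hW a x → ∃ p q, IsEdgeSelection W hW a c x p q := by
  obtain ⟨c, hc⟩ := exists_forall_notMem_of_ne_top
    fun k : (∀ i, W i) × (∀ i, W i) × Fin n =>
      Submodule.span ℝ ((fun j => (k.1 j : Fin n → ℝ) - k.2.1 j) '' {k.2.2}ᶜ)
  refine ⟨c, fun x hx => ?_⟩
  choose p hp q hq hpq hspan using fun i => exists_vectorSpan_eq_span_sub (hx.1 i)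
  have htop : Submodule.span ℝ (Set.range fun i => p i - q i) = ⊤ := by
    rw [Submodule.span_range_eq_iSup, ← hx.2]
    simp only [hspan]
  have hli : LinearIndependent ℝ fun i => p i - q i :=
    linearIndependent_of_top_le_span_of_card_eq_finrank htop.ge (by simp)
  obtain ⟨t, ht⟩ := (Submodule.mem_span_range_iff_exists_fun ℝ).1
    (show c ∈ Submodule.span ℝ (Set.range fun i => p i - q i) from htop ▸ Submodule.mem_top)
  have hne : ∀ i, t i ≠ 0 := by
    intro i hti
    refine hc ⟨fun j => ⟨p j, (Finset.mem_filter.1 (hp j)).1⟩,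
      fun j => ⟨q j, (Finset.mem_filter.1 (hq j)).1⟩, i⟩ ?_ ?_
    · intro h
      exact hli.notMem_span_image (s := {i}ᶜ) (x := i) (by simp) (h ▸ Submodule.mem_top)
    · rw [← ht]
      refine Submodule.sum_mem _ fun j _ => ?_
      by_cases hji : j = i
      · simp [hji, hti]
      · exact Submodule.smul_mem _ _ (Submodule.subset_span ⟨j, hji, rfl⟩)
  refine ⟨fun i => if 0 < t i then p i else q i, fun i => if 0 < t i then q i else p i,
    fun i => ?_, fun i => ?_, fun i => ?_, ?_, fun i => |t i|, fun i => abs_pos.2 (hne i), ?_⟩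
  · dsimp only
    split_ifs
    exacts [hp i, hq i]
  · dsimp only
    split_ifs
    exacts [hq i, hp i]
  · dsimp only
    split_ifs
    exacts [hpq i, (hpq i).symm]
  · refine top_le_iff.1 (htop ▸ Submodule.span_le.2 ?_)
    rintro _ ⟨i, rfl⟩
    have hmem := Submodule.subset_span (R := ℝ) (Set.mem_range_self
      (f := fun i => (if 0 < t i then p i else q i) - (if 0 < t i then q i else p i)) i)
    dsimp only at hmem ⊢
    split_ifs at hmem
    · exact hmem
    · rw [← neg_sub]
      exact Submodule.neg_mem _ hmem
  · rw [← ht]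
    refine Finset.sum_congr rfl fun i _ => ?_
    dsimp only
    split_ifs with h
    · rw [abs_of_pos h]
    · rw [abs_of_nonpos (not_lt.1 h), ← neg_sub (p i), smul_neg, neg_smul, neg_neg]

theorem add_le_of_mem_tropArgmax {n : ℕ} {W : Finset (Fin n → ℝ)} {hW : W.Nonempty}
    {a : (Fin n → ℝ) → ℝ} {x v w : Fin n → ℝ} (hv : v ∈ tropArgmax W hW a x) (hw : w ∈ W) :
    a w + w ⬝ᵥ x ≤ a v + v ⬝ᵥ x :=
  (Finset.le_sup' (fun w => a w + ∑ j, w j * x j) hw).trans (Finset.mem_filter.1 hv).2.ge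

/-- On the cell where all `p i` are maximizers, the solution from which `p` was selected is the
unique minimizer of the linear functional `c`. -/
theorem IsEdgeSelection.dotProduct_lt {n : ℕ} {W : Fin n → Finset (Fin n → ℝ)}
    {hW : ∀ i, (W i).Nonempty} {a : Fin n → (Fin n → ℝ) → ℝ} {c x y : Fin n → ℝ}
    {p q : Fin n → Fin n → ℝ} (h : IsEdgeSelection W hW a c y p q)
    (hx : ∀ i, p i ∈ tropArgmax (W i) (hW i) (a i) x) (hxy : x ≠ y) : c ⬝ᵥ y < c ⬝ᵥ x := by
  obtain ⟨hp, hq, -, htop, t, ht, rfl⟩ := h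
  have hnonneg : ∀ i, 0 ≤ (p i - q i) ⬝ᵥ (x - y) := by
    intro i
    have h1 := add_le_of_mem_tropArgmax (hx i) (Finset.mem_filter.1 (hq i)).1
    have h2 := add_le_of_mem_tropArgmax (hq i) (Finset.mem_filter.1 (hp i)).1
    simp only [sub_dotProduct, dotProduct_sub]
    linarith
  have hsum : (∑ i, t i • (p i - q i)) ⬝ᵥ (x - y) = ∑ i, t i * ((p i - q i) ⬝ᵥ (x - y)) := by
    simp only [sum_dotProduct, smul_dotProduct, smul_eq_mul]
  rw [← sub_pos, ← dotProduct_sub, hsum]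
  refine (Finset.sum_nonneg fun i _ => mul_nonneg (ht i).le (hnonneg i)).lt_of_ne' fun h0 => hxy ?_
  rw [Finset.sum_eq_zero_iff_of_nonneg fun i _ => mul_nonneg (ht i).le (hnonneg i)] at h0
  rw [← sub_eq_zero]
  refine dotProduct_eq_zero _ fun w => ?_
  have hw : w ∈ Submodule.span ℝ (Set.range fun i => p i - q i) := htop ▸ Submodule.mem_top
  rw [dotProduct_comm]
  induction hw using Submodule.span_induction with
  | mem u hu =>
    obtain ⟨i, rfl⟩ := hu
    exact (mul_eq_zero.1 (h0 i (Finset.mem_univ i))).resolve_left (ht i).ne'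
  | zero => exact zero_dotProduct _
  | add u v _ _ hu hv => rw [add_dotProduct, hu, hv, add_zero]
  | smul r u _ hu => rw [smul_dotProduct, hu, smul_zero]

/-- the set of nondegenerate solutions of a tropical polynomial system
with supports `W_1, …, W_n ⊂ ℝ^n` is finite and its cardinality is at most the
Kouchnirenko number `∏_{i=1}^n (|W_i| − 1)`. -/
theorem trop_card_le_kouchnirenko {n : ℕ} (hn : 1 ≤ n)
    (W : Fin n → Finset (Fin n → ℝ)) (hW : ∀ i, (W i).Nonempty)
    (a : Fin n → (Fin n → ℝ) → ℝ) :
    {x : Fin n → ℝ | IsNondegTropSol W hW a x}.Finite ∧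
    {x : Fin n → ℝ | IsNondegTropSol W hW a x}.ncard ≤ ∏ i : Fin n, ((W i).card - 1) := by
  classical
  obtain ⟨c, hc⟩ := exists_isEdgeSelection W hW a
  choose w₀ hw₀ using fun i => (hW i).exists_mem
  choose p q hpq using fun x : {x | IsNondegTropSol W hW a x} => hc x x.2
  -- tensor products of differences of point masses, and the evaluations at the tuples `p y`
  let v (x : {x | IsNondegTropSol W hW a x}) : (∀ i, ((W i).erase (w₀ i) : Finset _)) → ℝ :=
    fun w => ∏ i, ((if (w i).1 = p x i then 1 else 0) - (if (w i).1 = q x i then 1 else 0))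
  let φ (y : {x | IsNondegTropSol W hW a x}) :
      ((∀ i, ((W i).erase (w₀ i) : Finset _)) → ℝ) →ₗ[ℝ] ℝ :=
    Fintype.linearCombination ℝ fun w =>
      ∏ i, ((if (w i).1 = p y i then 1 else 0) - (if w₀ i = p y i then 1 else 0))
  have hφ : ∀ x y, φ y (v x) =
      ∏ i, ((if p x i = p y i then 1 else 0) - (if q x i = p y i then 1 else 0)) := by
    intro x y
    simp only [φ, v, Fintype.linearCombination_apply, smul_eq_mul, ← Finset.prod_mul_distrib]
    rw [← Fintype.prod_sum fun i (w : ((W i).erase (w₀ i) : Finset _)) =>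
      (((if w.1 = p x i then 1 else 0) - (if w.1 = q x i then 1 else 0)) *
        ((if w.1 = p y i then 1 else 0) - (if w₀ i = p y i then 1 else 0)) : ℝ)]
    exact Finset.prod_congr rfl fun i _ => sum_erase_single_sub_mul (W i)
      (Finset.mem_filter.1 ((hpq x).1 i)).1 (Finset.mem_filter.1 ((hpq x).2.1 i)).1 _
  have hli : LinearIndependent ℝ v := by
    refine linearIndependent_of_triangular v φ (fun x => c ⬝ᵥ x.1) (fun x => ?_) fun x y h hxy => ?_
    · rw [hφ]
      simp [((hpq x).2.2.1 _).symm]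
    · rw [hφ, Finset.prod_ne_zero_iff] at h
      refine (hpq y).dotProduct_lt (fun i => ?_) (Subtype.coe_ne_coe.2 hxy)
      by_cases hp : p x i = p y i
      · exact hp ▸ (hpq x).1 i
      by_cases hq : q x i = p y i
      · exact hq ▸ (hpq x).2.1 i
      simpa [hp, hq] using h i (Finset.mem_univ i)
  have hfin : Finite {x | IsNondegTropSol W hW a x} := hli.finite
  refine ⟨hfin, ?_⟩
  have := Fintype.ofFinite {x | IsNondegTropSol W hW a x}
  have hcard := hli.fintype_card_le_finrank
  rw [Module.finrank_fintype_fun_eq_card, Fintype.card_pi] at hcard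
  rw [← Nat.card_coe_set_eq, Nat.card_eq_fintype_card]
  simpa [Finset.card_erase_of_mem, hw₀] using hcard
end

section
/- For every n ≥ 1 and all integers m_1, …, m_n ≥ 1, there exist finite sets W_1, …, W_n ⊂ ℝ^n with |W_i| = m_i and coefficient maps a_i : W_i → ℝ such that the associated tropical polynomial system has exactly ∏_{i=1}^n (m_i − 1) nondegenerate solutions. (Hence the Kouchnirenko number is a sharp bound for tropical polynomial systems.) -/
open scoped Pointwise

/-- Nonnegative integer points on the `i`-th coordinate axis, the support of a tropical polynomial in
the single variable `x i`. -/
noncomputable def axisSupport {n : ℕ} (i : Fin n) (m : ℕ) : Finset (Fin n → ℝ) :=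
  (Finset.range m).image fun j : ℕ => Pi.single i (j : ℝ)

/-- The concave coefficients `-(t choose 2)`, for which the roots of the tropical polynomial on
`axisSupport i m` are `0, …, m - 2`. -/
noncomputable def axisCoeff {n : ℕ} (i : Fin n) (w : Fin n → ℝ) : ℝ :=
  -(w i * (w i - 1) / 2)

lemma card_axisSupport {n : ℕ} (i : Fin n) (m : ℕ) : (axisSupport i m).card = m := by
  rw [axisSupport, Finset.card_image_of_injective, Finset.card_range]
  exact (Pi.single_injective i).comp Nat.cast_injective

lemma axisSupport_nonempty {n : ℕ} (i : Fin n) {m : ℕ} (hm : 1 ≤ m) :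
    (axisSupport i m).Nonempty := by
  rw [← Finset.card_pos, card_axisSupport]
  exact hm

lemma mem_tropArgmax_iff {n : ℕ} {W : Finset (Fin n → ℝ)} (hW : W.Nonempty)
    (a : (Fin n → ℝ) → ℝ) (x w : Fin n → ℝ) :
    w ∈ tropArgmax W hW a x ↔
      w ∈ W ∧ ∀ v ∈ W, a v + ∑ j, v j * x j ≤ a w + ∑ j, w j * x j := by
  rw [tropArgmax, Finset.mem_filter, tropVal]
  refine and_congr_right fun hw => ⟨fun h v hv => ?_, fun h => le_antisymm ?_ ?_⟩
  · rw [h]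
    exact Finset.le_sup' (fun w => a w + ∑ j, w j * x j) hv
  · exact Finset.le_sup' (fun w => a w + ∑ j, w j * x j) hw
  · exact Finset.sup'_le hW _ h

lemma mem_tropArgmax_axis_iff {n : ℕ} (i : Fin n) {m : ℕ} (hW : (axisSupport i m).Nonempty)
    (x w : Fin n → ℝ) :
    w ∈ tropArgmax (axisSupport i m) hW (axisCoeff i) x ↔
      ∃ j : ℕ, j < m ∧ w = Pi.single i (j : ℝ) ∧ ∀ l : ℕ, l < m →
        -((l : ℝ) * (l - 1) / 2) + l * x i ≤ -((j : ℝ) * (j - 1) / 2) + j * x i := by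
  have hval (j : ℕ) : axisCoeff i (Pi.single i (j : ℝ)) +
      ∑ k, (Pi.single i (j : ℝ) : Fin n → ℝ) k * x k =
        -((j : ℝ) * (j - 1) / 2) + j * x i := by
    simp [axisCoeff, Pi.single_apply]
  rw [mem_tropArgmax_iff]
  simp only [axisSupport, Finset.mem_image, Finset.mem_range, forall_exists_index, and_imp,
    forall_apply_eq_imp_iff₂, hval]
  constructor
  · rintro ⟨⟨j, hj, rfl⟩, h⟩
    rw [hval] at h
    exact ⟨j, hj, rfl, h⟩
  · rintro ⟨j, hj, rfl, h⟩
    rw [hval]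
    exact ⟨⟨j, hj, rfl⟩, h⟩

lemma tropArgmax_axis_of_eq {n : ℕ} (i : Fin n) {m : ℕ} (hW : (axisSupport i m).Nonempty)
    {x : Fin n → ℝ} {k : ℕ} (hk : k < m - 1) (hx : x i = k) :
    (tropArgmax (axisSupport i m) hW (axisCoeff i) x : Set (Fin n → ℝ)) =
      {Pi.single i (k : ℝ), Pi.single i ((k + 1 : ℕ) : ℝ)} := by
  have key (l : ℕ) : (0 : ℝ) ≤ ((l : ℝ) - k) * (l - k - 1) := by
    rcases le_or_gt l k with h | h
    · have : (l : ℝ) ≤ k := by exact_mod_cast h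
      nlinarith
    · have : (k : ℝ) + 1 ≤ l := by exact_mod_cast h
      nlinarith
  ext w
  simp only [Finset.mem_coe, mem_tropArgmax_axis_iff, hx, Set.mem_insert_iff,
    Set.mem_singleton_iff]
  constructor
  · rintro ⟨j, hj, rfl, h⟩
    have hle := h k (by omega)
    have hzero : ((j : ℝ) - k) * (j - k - 1) = 0 := by nlinarith [key j]
    rcases mul_eq_zero.mp hzero with h0 | h0
    · left
      rw [sub_eq_zero.mp h0]
    · right
      congr 1
      push_cast
      linarith
  · rintro (rfl | rfl)
    · exact ⟨k, by omega, rfl, fun l _ => by nlinarith [key l]⟩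
    · exact ⟨k + 1, by omega, rfl, fun l _ => by push_cast; nlinarith [key l]⟩

lemma vectorSpan_tropArgmax_axis_of_eq {n : ℕ} (i : Fin n) {m : ℕ}
    (hW : (axisSupport i m).Nonempty) {x : Fin n → ℝ} {k : ℕ} (hk : k < m - 1) (hx : x i = k) :
    vectorSpan ℝ (tropArgmax (axisSupport i m) hW (axisCoeff i) x : Set (Fin n → ℝ)) =
      ℝ ∙ (Pi.single i 1 : Fin n → ℝ) := by
  rw [tropArgmax_axis_of_eq i hW hk hx, vectorSpan_pair_rev, vsub_eq_sub, ← Pi.single_sub]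
  simp

lemma exists_eq_natCast_of_tropArgmax_axis {n : ℕ} (i : Fin n) {m : ℕ}
    (hW : (axisSupport i m).Nonempty) {x : Fin n → ℝ}
    (h : (tropArgmax (axisSupport i m) hW (axisCoeff i) x : Set (Fin n → ℝ)).Nontrivial) :
    ∃ k : ℕ, k < m - 1 ∧ x i = k := by
  obtain ⟨v, hv, w, hw, hne⟩ := h
  obtain ⟨j, hj, rfl, hjmax⟩ := (mem_tropArgmax_axis_iff i hW x v).mp hv
  obtain ⟨l, hl, rfl, hlmax⟩ := (mem_tropArgmax_axis_iff i hW x w).mp hw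
  have hjl : j ≠ l := fun h => hne (by rw [h])
  clear hv hw hne
  wlog hlt : j < l generalizing j l
  · exact this l hl hlmax j hj hjmax hjl.symm (by omega)
  obtain ⟨p, rfl⟩ : ∃ p, l = p + 1 := ⟨l - 1, by omega⟩
  have hup := hjmax (j + 1) (by omega)
  have hlow := hlmax p (by omega)
  have hjp : (j : ℝ) ≤ p := by exact_mod_cast Nat.lt_succ_iff.mp hlt
  push_cast at hup hlow
  exact ⟨j, by omega, le_antisymm (by linarith) (by linarith)⟩

lemma isNondegTropSol_axis_iff {n : ℕ} {m : Fin n → ℕ}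
    (hW : ∀ i, (axisSupport i (m i)).Nonempty) (x : Fin n → ℝ) :
    IsNondegTropSol (fun i => axisSupport i (m i)) hW axisCoeff x ↔
      ∀ i, ∃ k : ℕ, k < m i - 1 ∧ x i = k := by
  constructor
  · rintro ⟨h, -⟩ i
    refine exists_eq_natCast_of_tropArgmax_axis i (hW i) ?_
    by_contra hs
    have hi := h i
    rw [vectorSpan_of_subsingleton ℝ (Set.not_nontrivial_iff.mp hs), finrank_bot] at hi
    exact zero_ne_one hi
  · intro h
    have hspan (i : Fin n) : vectorSpan ℝ
        (tropArgmax (axisSupport i (m i)) (hW i) (axisCoeff i) x : Set (Fin n → ℝ)) =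
          ℝ ∙ (Pi.single i 1 : Fin n → ℝ) := by
      obtain ⟨k, hk, hx⟩ := h i
      exact vectorSpan_tropArgmax_axis_of_eq i (hW i) hk hx
    refine ⟨fun i => ?_, ?_⟩
    · rw [hspan]
      exact finrank_span_singleton (by simp)
    · simp only [hspan]
      rw [← Submodule.span_range_eq_iSup, ← (Pi.basisFun ℝ (Fin n)).span_eq]
      congr 2
      ext i
      simp

/-- the Kouchnirenko bound is sharp for tropical polynomial systems:
for every `n ≥ 1` and prescribed support sizes `m_1, …, m_n ≥ 1` there are supports
`W_i ⊂ ℝ^n` with `|W_i| = m_i` and coefficient maps `a_i` such that the associated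
tropical system has exactly `∏ (m_i − 1)` nondegenerate solutions. -/
theorem trop_kouchnirenko_sharp (n : ℕ) (hn : 1 ≤ n) (m : Fin n → ℕ) (hm : ∀ i, 1 ≤ m i) :
    ∃ (W : Fin n → Finset (Fin n → ℝ)) (hW : ∀ i, (W i).Nonempty)
      (a : Fin n → (Fin n → ℝ) → ℝ),
      (∀ i, (W i).card = m i) ∧
      {x : Fin n → ℝ | IsNondegTropSol W hW a x}.Finite ∧
      {x : Fin n → ℝ | IsNondegTropSol W hW a x}.ncard = ∏ i : Fin n, (m i - 1) := by
  have hW (i : Fin n) := axisSupport_nonempty i (hm i)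
  have hset : {x : Fin n → ℝ | IsNondegTropSol (fun i => axisSupport i (m i)) hW axisCoeff x} =
      (fun (k : Fin n → ℕ) i => (k i : ℝ)) ''
        (Fintype.piFinset fun i => Finset.range (m i - 1) : Finset (Fin n → ℕ)) := by
    ext x
    simp only [Set.mem_ofPred_eq, isNondegTropSol_axis_iff, Set.mem_image, Finset.mem_coe,
      Fintype.mem_piFinset, Finset.mem_range]
    constructor
    · intro h
      choose k hk hx using h
      exact ⟨k, hk, funext fun i => (hx i).symm⟩
    · rintro ⟨k, hk, rfl⟩ i
      exact ⟨k i, hk i, rfl⟩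
  refine ⟨fun i => axisSupport i (m i), hW, axisCoeff, fun i => card_axisSupport i (m i), ?_, ?_⟩
  · rw [hset]
    exact (Finset.finite_toSet _).image _
  · rw [hset, Set.ncard_image_of_injective _
      (fun k l h => funext fun i => Nat.cast_injective (congrFun h i)), Set.ncard_coe_finset]
    simp
end

section
/- Let a_1, …, a_n and v_1, …, v_n be points of ℤ^n ⊂ ℝ^n with v_1, …, v_n linearly independent over ℝ, and let Q = Σ_{i=1}^n [a_i, a_i + v_i] be the Minkowski sum of the segments [a_i, a_i + v_i] (so Q is a parallelepiped of Euclidean volume |det(v_1,…,v_n)|). Then there exists ε > 0 such that for every δ ∈ ℝ^n satisfying ‖δ‖ < ε and δ ∉ span{v_i : i ∈ S} for every proper subset S ⊊ {1,…,n} (in particular δ ≠ 0), the number of points of ℤ^n contained in the translate δ + Q equals |det(v_1,…,v_n)|. -/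
open scoped Pointwise

/-- The set of lattice points of `ℝ^n`: points all of whose coordinates are integers. -/
def latticePts (n : ℕ) : Set (Fin n → ℝ) := {x | ∀ i, ∃ m : ℤ, x i = (m : ℝ)}

/-- Membership in a Minkowski sum of segments with linearly independent directions, in
coordinates with respect to the basis of directions. -/
theorem mem_sum_segment_add_basis_iff {ι E : Type*} [Fintype ι] [AddCommGroup E] [Module ℝ E]
    (b : Module.Basis ι ℝ E) (a : ι → E) (x : E) :
    x ∈ ∑ i, segment ℝ (a i) (a i + b i) ↔
      ∀ i, b.repr (x - ∑ j, a j) i ∈ Set.Icc (0 : ℝ) 1 := by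
  classical
  rw [Set.mem_finsetSum]
  constructor
  · rintro ⟨g, hg, rfl⟩ i
    have hseg : ∀ j, ∃ t ∈ Set.Icc (0 : ℝ) 1, a j + t • b j = g j := fun j => by
      simpa [segment_eq_image'] using hg (Finset.mem_univ j)
    choose t ht hgt using hseg
    have hsum : ∑ j, g j - ∑ j, a j = ∑ j, t j • b j := by
      simp only [← hgt, Finset.sum_add_distrib, add_sub_cancel_left]
    rw [hsum, b.repr_sum_self]
    exact ht i
  · intro h
    refine ⟨fun i => a i + b.repr (x - ∑ j, a j) i • b i, fun {i} _ => ?_, ?_⟩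
    · rw [segment_eq_image']
      exact ⟨_, h i, by simp⟩
    · rw [Finset.sum_add_distrib, b.sum_repr, add_sub_cancel]

/-- The coordinatewise inclusion of `ℤ^ι` into `ℝ^ι`. -/
def intCastPi (ι : Type*) : (ι → ℤ) →ₗ[ℤ] (ι → ℝ) :=
  ((Int.castAddHom ℝ).compLeft ι).toIntLinearMap

@[simp]
theorem intCastPi_apply {ι : Type*} (m : ι → ℤ) (i : ι) : intCastPi ι m i = (m i : ℝ) := rfl

theorem intCastPi_injective (ι : Type*) : Function.Injective (intCastPi ι) := fun x y h =>
  funext fun i => by simpa using congrFun h i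

theorem latticePts_eq_range (n : ℕ) : latticePts n = Set.range (intCastPi (Fin n)) := by
  ext x
  constructor
  · intro h
    choose m hm using h
    exact ⟨m, funext fun i => by simp [hm]⟩
  · rintro ⟨m, rfl⟩ i
    exact ⟨m i, rfl⟩

/-- The index of the lattice spanned by linearly independent integer vectors. -/
theorem card_quotient_span_range_eq_natAbs_det {ι : Type*} [Fintype ι] [DecidableEq ι]
    {w : ι → ι → ℤ} (hw : LinearIndependent ℤ w) :
    Nat.card ((ι → ℤ) ⧸ Submodule.span ℤ (Set.range w)) = (Matrix.of w).det.natAbs := by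
  rw [← Submodule.natAbs_det_basis_change (Pi.basisFun ℤ ι) _ (Module.Basis.span hw),
    Pi.basisFun_det_apply]
  congr 2
  ext i j
  simp [Module.Basis.span_apply]

theorem exists_repr_eq_intCast_of_mem_span {ι : Type*} [Fintype ι]
    (b : Module.Basis ι ℝ (ι → ℝ)) {w : ι → ι → ℤ} (hb : ∀ i, b i = intCastPi ι (w i))
    {m : ι → ℤ} (hm : m ∈ Submodule.span ℤ (Set.range w)) :
    ∃ k : ι → ℤ, ∀ i, b.repr (intCastPi ι m) i = (k i : ℝ) := by
  obtain ⟨k, rfl⟩ := (Submodule.mem_span_range_iff_exists_fun ℤ).1 hm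
  refine ⟨k, fun i => ?_⟩
  have h : intCastPi ι (∑ j, k j • w j) = ∑ j, (k j : ℝ) • b j := by
    simp only [map_sum, map_smul, hb, Int.cast_smul_eq_zsmul]
  rw [h, b.repr_sum_self]

/-- A half-open parallelepiped, in any position, contains exactly one representative of each
class modulo the lattice spanned by its edges. -/
theorem ncard_halfOpen_parallelepiped {ι : Type*} [Fintype ι]
    (b : Module.Basis ι ℝ (ι → ℝ)) {w : ι → ι → ℤ} (hb : ∀ i, b i = intCastPi ι (w i))
    (p : ι → ℝ) :
    {m : ι → ℤ | ∀ i, b.repr (intCastPi ι m - p) i ∈ Set.Ico (0 : ℝ) 1}.ncard =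
      Nat.card ((ι → ℤ) ⧸ Submodule.span ℤ (Set.range w)) := by
  rw [← Nat.card_coe_set_eq]
  refine Nat.card_congr (Equiv.ofBijective
    (fun m => (Submodule.Quotient.mk m.1 : (ι → ℤ) ⧸ Submodule.span ℤ (Set.range w))) ⟨?_, ?_⟩)
  · rintro ⟨m, hm⟩ ⟨m', hm'⟩ h
    obtain ⟨k, hk⟩ := exists_repr_eq_intCast_of_mem_span b hb ((Submodule.Quotient.eq _).1 h)
    refine Subtype.ext (intCastPi_injective ι (b.repr.injective (Finsupp.ext fun i => ?_)))
    have h1 := hm i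
    have h2 := hm' i
    have h3 := hk i
    simp only [map_sub, Finsupp.sub_apply, Set.mem_Ico] at h1 h2 h3
    have hlt : k i < 1 := by exact_mod_cast (by linarith : (k i : ℝ) < 1)
    have hgt : -1 < k i := by exact_mod_cast (by linarith : (-1 : ℝ) < k i)
    have hk0 : k i = 0 := by omega
    rw [hk0, Int.cast_zero] at h3
    exact sub_eq_zero.1 h3
  · intro q
    obtain ⟨m, rfl⟩ := Submodule.Quotient.mk_surjective _ q
    set f : ι → ℤ := fun i => ⌊b.repr (intCastPi ι m - p) i⌋
    have hcast : intCastPi ι (∑ j, f j • w j) = ∑ j, (f j : ℝ) • b j := by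
      simp only [map_sum, map_smul, hb, Int.cast_smul_eq_zsmul]
    refine ⟨⟨m - ∑ j, f j • w j, fun i => ?_⟩, ?_⟩
    · rw [map_sub (intCastPi ι), hcast, sub_right_comm, map_sub, Finsupp.sub_apply, b.repr_sum_self]
      exact ⟨Int.fract_nonneg _, Int.fract_lt_one _⟩
    · refine (Submodule.Quotient.eq _).2 ?_
      rw [sub_sub_cancel_left]
      exact neg_mem ((Submodule.mem_span_range_iff_exists_fun ℤ).2 ⟨f, rfl⟩)

theorem exists_pos_forall_norm_lt_abs_repr_lt {ι : Type*} [Fintype ι] {E : Type*}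
    [NormedAddCommGroup E] [NormedSpace ℝ E] (b : Module.Basis ι ℝ E) {η : ℝ} (hη : 0 < η) :
    ∃ ε > 0, ∀ x : E, ‖x‖ < ε → ∀ i, |b.repr x i| < η := by
  have := b.finiteDimensional_of_finite
  have hcont : Continuous b.equivFun := b.equivFun.toLinearMap.continuous_of_finiteDimensional
  obtain ⟨ε, hε, h⟩ := Metric.continuous_iff.1 hcont 0 η hη
  refine ⟨ε, hε, fun x hx i => ?_⟩
  have := h x (by simpa using hx)
  rw [map_zero, dist_zero_right] at this
  exact (norm_le_pi_norm (b.equivFun x) i).trans_lt this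

theorem repr_ne_zero_of_notMem_span {ι K E : Type*} [Field K] [AddCommGroup E] [Module K E]
    [Fintype ι] (b : Module.Basis ι K E) {x : E}
    (h : ∀ S : Finset ι, S ≠ Finset.univ → x ∉ Submodule.span K (b '' (S : Set ι))) (i : ι) :
    b.repr x i ≠ 0 := fun h0 =>
  h (b.repr x).support (fun hS => Finsupp.mem_support_iff.1 (hS ▸ Finset.mem_univ i) h0)
    (b.mem_span_repr_support x)

/-- for lattice points `a_i` and linearly independent lattice vectors
`v_i`, let `Q = Σ_i [a_i, a_i + v_i]` be the parallelepiped obtained as Minkowski sum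
of segments.  Then for every sufficiently small `δ` which does not lie in the span of
any proper subfamily of the `v_i` (in particular `δ ≠ 0`), the number of lattice
points in the translate `δ + Q` is `|det(v_1,…,v_n)|`. -/
theorem lattice_points_of_translated_parallelepiped {n : ℕ}
    (a v : Fin n → (Fin n → ℝ))
    (ha : ∀ i, a i ∈ latticePts n) (hv : ∀ i, v i ∈ latticePts n)
    (hli : LinearIndependent ℝ v) :
    ∃ ε > (0 : ℝ), ∀ δ : Fin n → ℝ, ‖δ‖ < ε →
      (∀ S : Finset (Fin n), S ≠ Finset.univ →
        δ ∉ Submodule.span ℝ (v '' (S : Set (Fin n)))) →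
      ((latticePts n ∩
          ((fun x => δ + x) '' (∑ i : Fin n, segment ℝ (a i) (a i + v i)))).ncard : ℝ)
        = |(Matrix.of fun i j => v j i).det| := by
  obtain ⟨w, hw⟩ : ∃ w : Fin n → Fin n → ℤ, ∀ i, intCastPi (Fin n) (w i) = v i := by
    simp only [latticePts_eq_range] at hv
    choose w hw using hv
    exact ⟨w, hw⟩
  obtain ⟨A, hA⟩ : ∃ A : Fin n → ℤ, intCastPi (Fin n) A = ∑ i, a i := by
    simp only [latticePts_eq_range] at ha
    choose A hA using ha
    exact ⟨∑ i, A i, by simp [hA]⟩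
  let b : Module.Basis (Fin n) ℝ (Fin n → ℝ) :=
    basisOfLinearIndependentOfCardEqFinrank' v hli (by simp)
  have hbv : ⇑b = v := coe_basisOfLinearIndependentOfCardEqFinrank' v hli (by simp)
  have hb : ∀ i, b i = intCastPi (Fin n) (w i) := fun i => by rw [hbv, hw]
  have hliw : LinearIndependent ℤ w := by
    refine LinearIndependent.of_comp (intCastPi (Fin n)) ?_
    rw [show ⇑(intCastPi (Fin n)) ∘ w = v from funext hw]
    exact hli.restrict_scalars' ℤ
  have hcard := card_quotient_span_range_eq_natAbs_det hliw
  have hdet : (Matrix.of fun i j => v j i).det = ((Matrix.of w).det : ℝ) := by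
    rw [← Matrix.det_transpose, Int.cast_det]
    congr 1
    ext i j
    simp [← hw]
  set K := Nat.card ((Fin n → ℤ) ⧸ Submodule.span ℤ (Set.range w)) with hK
  have hKpos : 0 < K := by
    rw [hcard, Int.natAbs_pos, ← Int.cast_ne_zero (α := ℝ), ← hdet, ← Matrix.det_transpose]
    have hu := (Matrix.linearIndependent_rows_iff_isUnit (A := Matrix.of v)).1 hli
    exact ((Matrix.isUnit_iff_isUnit_det _).1 hu).ne_zero
  have hK0 : (0 : ℝ) < K := by exact_mod_cast hKpos
  obtain ⟨ε, hε, hsmall⟩ := exists_pos_forall_norm_lt_abs_repr_lt b (inv_pos.2 hK0)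
  refine ⟨ε, hε, fun δ hδ hgen => ?_⟩
  have hne := repr_ne_zero_of_notMem_span b (x := δ) (by rwa [hbv])
  have hnotint : ∀ (m : Fin n → ℤ) (i : Fin n),
      b.repr (intCastPi (Fin n) m) i - b.repr δ i ≠ 1 := by
    intro m i h
    have hmem : K • m ∈ Submodule.span ℤ (Set.range w) := by
      rw [← Submodule.Quotient.mk_eq_zero, Submodule.Quotient.mk_smul]
      exact card_nsmul_eq_zero'
    obtain ⟨k, hk⟩ := exists_repr_eq_intCast_of_mem_span b hb hmem
    have hki := hk i
    rw [map_nsmul, map_nsmul, Finsupp.smul_apply, nsmul_eq_mul] at hki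
    have hKδ : (K : ℝ) * b.repr δ i = ((k i - K : ℤ) : ℝ) := by
      push_cast
      linear_combination hki - (K : ℝ) * h
    have habs : |(K : ℝ) * b.repr δ i| < 1 := by
      rw [abs_mul, abs_of_pos hK0, mul_comm]
      exact (lt_inv_mul_iff₀' hK0).1 (by simpa using hsmall δ hδ i)
    rw [hKδ, ← Int.cast_abs] at habs
    have hz : k i - K = 0 := Int.abs_lt_one_iff.1 (by exact_mod_cast habs)
    rw [hz, Int.cast_zero, mul_eq_zero] at hKδ
    exact hKδ.elim hK0.ne' (hne i)
  have hset : latticePts n ∩ ((fun x => δ + x) '' ∑ i, segment ℝ (a i) (a i + v i)) =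
      intCastPi (Fin n) '' {m | ∀ i, b.repr (intCastPi (Fin n) m -
        (intCastPi (Fin n) A + δ)) i ∈ Set.Ico (0 : ℝ) 1} := by
    rw [latticePts_eq_range, Set.inter_comm, ← Set.image_preimage_eq_inter_range]
    congr 1
    ext m
    rw [Set.mem_preimage, Set.image_add_left, Set.mem_preimage, ← hbv,
      mem_sum_segment_add_basis_iff, ← hA, Set.mem_ofPred_eq]
    refine forall_congr' fun i => ?_
    rw [show -δ + intCastPi (Fin n) m - intCastPi (Fin n) A =
      intCastPi (Fin n) m - (intCastPi (Fin n) A + δ) by abel]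
    refine ⟨fun h => ⟨h.1, h.2.lt_of_ne fun h1 => hnotint (m - A) i ?_⟩,
      fun h => Set.Ico_subset_Icc_self h⟩
    rw [← h1, ← Finsupp.sub_apply, ← map_sub, map_sub (intCastPi (Fin n)), sub_sub]
  rw [hset, Set.ncard_image_of_injective _ (intCastPi_injective _),
    ncard_halfOpen_parallelepiped b hb, ← hK, hcard, hdet, Nat.cast_natAbs, Int.cast_abs]
end

section
/- Let v_1, …, v_n ∈ ℝ^n be linearly independent, let a_1, …, a_n ∈ ℝ^n, and let Q = Σ_{i=1}^n [a_i, a_i + v_i] be the Minkowski sum of the segments [a_i, a_i + v_i]. Then there exists ε > 0 such that for every δ ∈ ℝ^n with ‖δ‖ < ε, some vertex of Q lies in δ + Q; that is, there exist ε_1, …, ε_n ∈ {0,1} with Σ_{i=1}^n (a_i + ε_i v_i) ∈ δ + Q. -/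
open scoped Pointwise

/-- let `v_1, …, v_n ∈ ℝ^n` be linearly independent and
`Q = Σ_i [a_i, a_i + v_i]` (Minkowski sum of segments).  Then for every sufficiently
small `δ`, some vertex `Σ_i (a_i + ε_i v_i)` of `Q` (with each `ε_i ∈ {0,1}`) lies in
the translate `δ + Q`. -/
theorem vertex_mem_translated_parallelepiped {n : ℕ}
    (v a : Fin n → (Fin n → ℝ)) (hli : LinearIndependent ℝ v) :
    ∃ ε > (0 : ℝ), ∀ δ : Fin n → ℝ, ‖δ‖ < ε →
      ∃ e : Fin n → ℝ, (∀ i, e i = 0 ∨ e i = 1) ∧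
        (∑ i : Fin n, (a i + e i • v i)) ∈
          (fun x => δ + x) '' (∑ i : Fin n, segment ℝ (a i) (a i + v i)) := by
  let b := Module.Basis.mk hli (hli.span_eq_top_of_card_eq_finrank' (by simp)).ge
  have hcont : Continuous b.equivFun := b.equivFun.toLinearMap.continuous_of_finiteDimensional
  obtain ⟨ε, hε, hsmall⟩ := Metric.continuousAt_iff.mp (hcont.continuousAt (x := 0)) 1 one_pos
  refine ⟨ε, hε, fun δ hδ => ?_⟩
  set c := b.equivFun δ
  have hcnorm : ‖c‖ < 1 := by
    have h := hsmall (x := δ) (by simpa using hδ)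
    rwa [map_zero, dist_zero_right] at h
  have hcabs (i : Fin n) : |c i| < 1 := (norm_le_pi_norm c i).trans_lt hcnorm
  have hsum : ∑ i, c i • v i = δ := by
    simpa only [b, Module.Basis.mk_apply] using b.sum_equivFun δ
  let e : Fin n → ℝ := fun i => if 0 ≤ c i then 1 else 0
  refine ⟨e, fun i => by by_cases h : 0 ≤ c i <;> simp [e, h],
    ∑ i, (a i + (e i - c i) • v i), ?_, ?_⟩
  · refine Set.finsetSum_mem_finsetSum _ _ _ fun i _ => ?_
    rw [segment_eq_image']
    refine ⟨e i - c i, ?_, by simp⟩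
    have h := abs_lt.mp (hcabs i)
    by_cases hi : 0 ≤ c i
    · simp only [e, hi, if_true, Set.mem_Icc]
      constructor <;> linarith
    · simp only [e, hi, if_false, Set.mem_Icc]
      constructor <;> linarith
  · change δ + _ = _
    rw [← hsum, ← Finset.sum_add_distrib]
    refine Finset.sum_congr rfl fun i _ => ?_
    module
end

section
/- Let P ⊆ ℝ^n be a convex set, let W ⊆ P be a finite subset, and let δ ∈ ℝ^n. Define the lower part of P with respect to δ as L = {x ∈ P : x − sδ ∉ P for every s > 0}. Then there exists ε > 0 such that for every t ∈ (0, ε), W is the disjoint union of W ∩ (tδ + P) and W ∩ L. -/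
open scoped Pointwise

open Filter Topology in
/-- For a point `x` of a convex set `P`, either all sufficiently short steps in direction `-δ`
stay in `P`, or every step leaves `P`. -/
theorem Convex.eventually_sub_smul_mem_or_forall_notMem {E : Type*} [AddCommGroup E] [Module ℝ E]
    {P : Set E} (hP : Convex ℝ P) {x : E} (hx : x ∈ P) (δ : E) :
    ∀ᶠ t : ℝ in 𝓝[>] 0, x - t • δ ∈ P ∨ ∀ s : ℝ, 0 < s → x - s • δ ∉ P := by
  by_cases h : ∀ s : ℝ, 0 < s → x - s • δ ∉ P
  · exact Eventually.of_forall fun _ => Or.inr h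
  · push Not at h
    obtain ⟨s, hs, hxs⟩ := h
    filter_upwards [Ioo_mem_nhdsGT hs] with t ht
    left
    have hmem := hP.add_smul_sub_mem hx hxs
      (t := t / s) ⟨(div_pos ht.1 hs).le, (div_le_one hs).2 ht.2.le⟩
    have heq : x + (t / s) • (x - s • δ - x) = x - t • δ := by
      rw [sub_sub_cancel_left, smul_neg, smul_smul, div_mul_cancel₀ t hs.ne', ← sub_eq_add_neg]
    rwa [heq] at hmem

/-- let `P ⊆ ℝ^n` be convex, `W ⊆ P` finite and `δ ∈ ℝ^n`.  With
`L = {x ∈ P : x − sδ ∉ P for all s > 0}` (the lower part of `P` with respect to `δ`),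
there is `ε > 0` such that for all `t ∈ (0, ε)`, `W` is the disjoint union of
`W ∩ (tδ + P)` and `W ∩ L`. -/
theorem finite_set_split_lower_part {n : ℕ} (P : Set (Fin n → ℝ)) (hP : Convex ℝ P)
    (W : Set (Fin n → ℝ)) (hWP : W ⊆ P) (hWfin : W.Finite) (δ : Fin n → ℝ) :
    ∃ ε > (0 : ℝ), ∀ t : ℝ, 0 < t → t < ε →
      ((W ∩ ((fun x => t • δ + x) '' P)) ∪
        (W ∩ {x ∈ P | ∀ s : ℝ, 0 < s → x - s • δ ∉ P}) = W) ∧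
      Disjoint (W ∩ ((fun x => t • δ + x) '' P))
        (W ∩ {x ∈ P | ∀ s : ℝ, 0 < s → x - s • δ ∉ P}) := by
  have hev := (Filter.eventually_all_finite hWfin).2 fun w hw =>
    hP.eventually_sub_smul_mem_or_forall_notMem (hWP hw) δ
  obtain ⟨ε, hε, hsub⟩ := mem_nhdsGT_iff_exists_Ioo_subset.1 hev
  refine ⟨ε, hε, fun t ht htε => ⟨?_, ?_⟩⟩
  · refine Set.Subset.antisymm (Set.union_subset Set.inter_subset_left Set.inter_subset_left) ?_
    intro w hw
    rcases hsub ⟨ht, htε⟩ w hw with h | h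
    · exact Or.inl ⟨hw, w - t • δ, h, add_sub_cancel _ _⟩
    · exact Or.inr ⟨hw, hWP hw, h⟩
  · rw [Set.disjoint_left]
    rintro _ ⟨-, x, hx, rfl⟩ ⟨-, -, h⟩
    exact h t ht (by simpa using hx)
end
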